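/- arXiv:1407.5638 — 2 statements merged into one kernel-verified Lean document; each statement's English description precedes it below -/
import Mathlib

section
/- Let q = p^h, let U ⊆ GF(q)^2 be nonempty with Rédei polynomial R(X,Y), and define Q(X,Y) and H(X,Y) by dividing X^q − X by R(X,Y) in X over GF(q)[Y], so that R(X,Y)·Q(X,Y) = X^q + H(X,Y) with deg_X H < deg_X R. If y ∈ GF(q) is a determined direction (y ∈ D), then Q(X,y) ∈ GF(q)[X^{s(y)}] and H(X,y) ∈ GF(q)[X^{s(y)}]. -/
open Polynomial
open scoped Classical

noncomputable section

/-- The direction determined by two points of `AG(2,q) = F × F`; `none` denotes the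
vertical direction `∞`, and `some m` denotes the slope `m = (b-d)/(a-c)`. -/
def direction {F : Type*} [Field F] (P Q : F × F) : Option F :=
  if P.1 = Q.1 then none else some ((P.2 - Q.2) / (P.1 - Q.1))

/-- The set of directions determined by a set `U` of affine points. -/
def dirSet {F : Type*} [Field F] (U : Set (F × F)) : Set (Option F) :=
  {d | ∃ P ∈ U, ∃ Q ∈ U, P ≠ Q ∧ direction P Q = d}

/-- Membership in the affine line with direction `y` and parameter `c`:
for `y = some m` the line `{(u,w) | w = m·u + c}`, for `y = none` the vertical line
`{(u,w) | u = c}`. -/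
def onLine {F : Type*} [Field F] (y : Option F) (c : F) (P : F × F) : Prop :=
  match y with
  | none => P.1 = c
  | some m => P.2 = m * P.1 + c

/-- The number of points of `U` on the affine line with direction `y` and parameter `c`. -/
def lineCount {F : Type*} [Field F] (U : Set (F × F)) (y : Option F) (c : F) : ℕ :=
  {P ∈ U | onLine y c P}.ncard

/-- `s(y)`: the gcd of the intersection sizes of `U` with the lines of direction `y`,
together with `q`. -/
def sdir {F : Type*} [Field F] [Fintype F] (U : Set (F × F)) (y : Option F) : ℕ :=
  Nat.gcd (Fintype.card F) (Finset.univ.gcd fun c : F => lineCount U y c)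

/-- `s`: the minimum of `s(y)` over the determined directions. -/
def sMin {F : Type*} [Field F] [Fintype F] (U : Set (F × F)) : ℕ :=
  sInf (sdir U '' dirSet U)

/-- The Rédei polynomial `R(X,Y) = ∏_{(a,b)∈U} (X - aY + b)`, as a polynomial in `X`
with coefficients in `GF(q)[Y]`. -/
def redei {F : Type*} [Field F] (U : Finset (F × F)) : Polynomial (Polynomial F) :=
  ∏ P ∈ U, (X - C (C P.1 * X - C P.2))

/-- The quotient `Q(X,Y)` of `X^q - X` upon Euclidean division (in `X`) by the
(monic in `X`) Rédei polynomial. -/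
def Qpoly {F : Type*} [Field F] [Fintype F] (U : Finset (F × F)) : Polynomial (Polynomial F) :=
  (X ^ Fintype.card F - X) /ₘ redei U

/-- `H(X,Y)`, defined by `-X - H(X,Y) = (X^q - X) mod R(X,Y)`, so that
`R·Q = X^q + H` with `deg_X H < deg_X R`. -/
def Hpoly {F : Type*} [Field F] [Fintype F] (U : Finset (F × F)) : Polynomial (Polynomial F) :=
  -X - (X ^ Fintype.card F - X) %ₘ redei U

/-- The evaluation `R(X,y)` of the Rédei polynomial at `Y = y`. -/
def redeiAt {F : Type*} [Field F] (U : Finset (F × F)) (y : F) : Polynomial F :=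
  (redei U).map (evalRingHom y)

/-- The evaluation `Q(X,y)`. -/
def QAt {F : Type*} [Field F] [Fintype F] (U : Finset (F × F)) (y : F) : Polynomial F :=
  (Qpoly U).map (evalRingHom y)

/-- The evaluation `H(X,y)`. -/
def HAt {F : Type*} [Field F] [Fintype F] (U : Finset (F × F)) (y : F) : Polynomial F :=
  (Hpoly U).map (evalRingHom y)

/-- `g ∈ R[X^r]`: every power of `X` occurring in `g` with nonzero coefficient has
exponent divisible by `r`. -/
def inXpow {R : Type*} [Semiring R] (r : ℕ) (g : Polynomial R) : Prop :=
  ∀ i : ℕ, g.coeff i ≠ 0 → r ∣ i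

theorem inXpow_expand {R : Type*} [CommRing R] {r : ℕ} (hr : 0 < r) (g : R[X]) :
    inXpow r (expand R r g) := by
  intro i hi
  by_contra hd
  exact hi (by rw [coeff_expand hr, if_neg hd])

theorem degree_expand_lt {R : Type*} [CommRing R] {r : ℕ} (hr : 0 < r) (f g : R[X])
    (hfg : f.degree < g.degree) : (expand R r f).degree < (expand R r g).degree := by
  have hg : g ≠ 0 := by
    rintro rfl
    simp at hfg
  have hg' : expand R r g ≠ 0 := (expand_ne_zero hr).2 hg
  by_cases hf : f = 0
  · subst hf
    rw [map_zero, degree_zero]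
    exact bot_lt_iff_ne_bot.2 (fun h => hg' (degree_eq_bot.1 h))
  have hf' : expand R r f ≠ 0 := (expand_ne_zero hr).2 hf
  rw [degree_eq_natDegree hf, degree_eq_natDegree hg] at hfg
  rw [degree_eq_natDegree hf', degree_eq_natDegree hg', natDegree_expand, natDegree_expand]
  have : f.natDegree < g.natDegree := by exact_mod_cast hfg
  exact_mod_cast Nat.mul_lt_mul_of_pos_right this hr

theorem redei_monic {F : Type*} [Field F] (U : Finset (F × F)) : (redei U).Monic :=
  monic_prod_of_monic _ _ fun _ _ => monic_X_sub_C _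

theorem redeiAt_eq {F : Type*} [Field F] (U : Finset (F × F)) (y : F) :
    redeiAt U y = ∏ P ∈ U, (X + C (P.2 - y * P.1)) := by
  unfold redeiAt redei
  rw [Polynomial.map_prod]
  refine Finset.prod_congr rfl fun P _ => ?_
  simp
  ring

theorem redeiAt_natDegree {F : Type*} [Field F] (U : Finset (F × F)) (y : F) :
    (redeiAt U y).natDegree = U.card := by
  rw [redeiAt_eq, natDegree_prod_of_monic _ _ fun _ _ => monic_X_add_C _]
  simp only [natDegree_X_add_C, Finset.sum_const, smul_eq_mul, mul_one]

theorem redeiAt_eq_lines {F : Type*} [Field F] [Fintype F] (U : Finset (F × F)) (y : F) :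
    redeiAt U y = ∏ c : F, (X + C c) ^ lineCount (↑U : Set (F × F)) (some y) c := by
  rw [redeiAt_eq, ← Finset.prod_fiberwise U (fun P => P.2 - y * P.1)]
  refine Finset.prod_congr rfl fun c _ => ?_
  have hc : lineCount (↑U : Set (F × F)) (some y) c
      = (U.filter (fun P => P.2 - y * P.1 = c)).card := by
    unfold lineCount
    rw [← Set.ncard_coe_finset]
    congr 1
    ext P
    simp only [onLine, Set.mem_ofPred_eq, Finset.coe_filter, Finset.mem_coe, sub_eq_iff_eq_add']
  rw [hc]
  refine Finset.prod_eq_pow_card fun P hP => ?_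
  rw [(Finset.mem_filter.1 hP).2]

/-- For a nonempty `U ⊆ AG(2,q)` and a determined direction
`y ∈ D ∩ GF(q)`, both `Q(X,y)` and `H(X,y)` lie in `GF(q)[X^{s(y)}]`. -/
theorem Q_and_H_at_determined_direction
    {F : Type*} [Field F] [Fintype F] (p h : ℕ) (hp : p.Prime) (hh : 0 < h)
    (hcard : Fintype.card F = p ^ h) (U : Finset (F × F)) (hU : U.Nonempty)
    (y : F) (hy : some y ∈ dirSet (↑U : Set (F × F))) :
    inXpow (sdir (↑U : Set (F × F)) (some y)) (QAt U y) ∧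
      inXpow (sdir (↑U : Set (F × F)) (some y)) (HAt U y) := by
  set s := sdir (↑U : Set (F × F)) (some y) with hs
  have : Fact p.Prime := ⟨hp⟩
  have : CharP F p := charP_of_card_eq_prime_pow hcard
  have hsq : s ∣ Fintype.card F := Nat.gcd_dvd_left _ _
  have hsl : ∀ c : F, s ∣ lineCount (↑U : Set (F × F)) (some y) c := fun c =>
    (Nat.gcd_dvd_right _ _).trans (Finset.gcd_dvd (Finset.mem_univ c))
  have hs0 : 0 < s := Nat.pos_of_dvd_of_pos hsq Fintype.card_pos
  obtain ⟨k, -, hk⟩ := (Nat.dvd_prime_pow hp).1 (hcard ▸ hsq)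
  obtain ⟨n, hn⟩ := hsq
  choose m hm using hsl
  set g : F[X] := ∏ c : F, (X + C (c ^ s)) ^ m c with hg
  have hgm : g.Monic := monic_prod_of_monic _ _ fun c _ => (monic_X_add_C _).pow _
  have hR : redeiAt U y = expand F s g := by
    rw [redeiAt_eq_lines, hg, map_prod]
    refine Finset.prod_congr rfl fun c _ => ?_
    rw [hm c, pow_mul, map_pow, map_add, expand_X, expand_C, C_pow]
    congr 1
    rw [hk, add_pow_char_pow]
  have hRm : (redeiAt U y).Monic := (redei_monic U).map _
  have hcardU : 1 < U.card := by
    obtain ⟨P, hP, Q, hQ, hPQ, -⟩ := hy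
    exact Finset.one_lt_card.2 ⟨P, hP, Q, hQ, hPQ⟩
  have hXdeg : (X : F[X]).degree < (redeiAt U y).degree := by
    rw [degree_X, degree_eq_natDegree hRm.ne_zero, redeiAt_natDegree]
    exact_mod_cast hcardU
  have key := div_modByMonic_unique (f := X ^ Fintype.card F - X) (g := redeiAt U y)
    (expand F s (X ^ n /ₘ g)) (expand F s (X ^ n %ₘ g) - X) hRm (by
      constructor
      · have h1 := congrArg (expand F s) (modByMonic_add_div (X ^ n) g)
        rw [map_add, map_mul, map_pow, expand_X, ← pow_mul, ← hn, ← hR] at h1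
        rw [← h1]
        ring
      · refine (degree_sub_le _ _).trans_lt (max_lt ?_ hXdeg)
        rw [hR]
        exact degree_expand_lt hs0 _ _ (degree_modByMonic_lt _ hgm))
  have hQ : QAt U y = expand F s (X ^ n /ₘ g) := by
    rw [← key.1]
    unfold QAt Qpoly
    rw [map_divByMonic _ (redei_monic U)]
    simp [redeiAt]
  have hH : HAt U y = expand F s (-(X ^ n %ₘ g)) := by
    have h2 : HAt U y = -X - (X ^ Fintype.card F - X) %ₘ redeiAt U y := by
      unfold HAt Hpoly
      rw [Polynomial.map_sub, map_modByMonic _ (redei_monic U)]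
      simp [redeiAt]
    rw [h2, key.2, map_neg]
    ring
  rw [hQ, hH]
  exact ⟨inXpow_expand hs0 _, inXpow_expand hs0 _⟩
end
end

section
/- Let F be a field of characteristic p > 0, let s = p^e and q = p^h with e ≤ h, and let P ∈ F[X] be a nonzero polynomial with P ∈ F[X^s]. Then both the quotient X^q div P and the remainder X^q mod P lie in F[X^s]. -/
open Polynomial

noncomputable section

theorem inXpow_expand_s18 {F : Type*} [Field F] (s : ℕ) (hs : 0 < s) (g : Polynomial F) :
    inXpow s (expand F s g) := by
  intro i hi
  by_contra hn
  rw [coeff_expand hs, if_neg hn] at hi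
  exact hi rfl

theorem exists_expand_of_inXpow {F : Type*} [Field F] (s : ℕ) (hs : 0 < s) (g : Polynomial F)
    (hg : inXpow s g) : expand F s (contract s g) = g := by
  ext i
  rw [coeff_expand hs]
  split_ifs with hd
  · rw [coeff_contract hs.ne', Nat.div_mul_cancel hd]
  · by_contra hne
    exact hd (hg i (Ne.symm hne))

theorem div_mod_expand {F : Type*} [Field F] (s : ℕ) (hs : 0 < s) (A B : Polynomial F)
    (hB : B ≠ 0) :
    expand F s A / expand F s B = expand F s (A / B) ∧
      expand F s A % expand F s B = expand F s (A % B) := by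
  have hE : expand F s B ≠ 0 := (expand_ne_zero hs).2 hB
  have h1 : expand F s B * expand F s (A / B) + expand F s (A % B) = expand F s A := by
    rw [← map_mul, ← map_add, EuclideanDomain.div_add_mod]
  have h2 := EuclideanDomain.div_add_mod (expand F s A) (expand F s B)
  have d2 : (expand F s A % expand F s B).degree < (expand F s B).degree :=
    EuclideanDomain.mod_lt _ hE
  have d1 : (expand F s (A % B)).degree < (expand F s B).degree := by
    by_cases h0 : A % B = 0
    · rw [h0, map_zero, degree_zero]
      exact bot_lt_iff_ne_bot.2 (degree_ne_bot.2 hE)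
    · have hd : (A % B).degree < B.degree := EuclideanDomain.mod_lt _ hB
      apply degree_lt_degree
      rw [natDegree_expand, natDegree_expand]
      exact Nat.mul_lt_mul_of_pos_right (natDegree_lt_natDegree h0 hd) hs
  have key : expand F s B * (expand F s A / expand F s B - expand F s (A / B)) =
      expand F s (A % B) - expand F s A % expand F s B := by
    linear_combination h2 - h1
  have hz := eq_zero_of_dvd_of_degree_lt (Dvd.intro _ key)
    (lt_of_le_of_lt (degree_sub_le _ _) (max_lt d1 d2))
  rw [hz] at key
  exact ⟨sub_eq_zero.1 ((mul_eq_zero.1 key).resolve_left hE), (sub_eq_zero.1 hz).symm⟩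

/-- Let `F` be a field of characteristic `p > 0`, `s = p^e`,
`q = p^h` with `e ≤ h`, and let `P ∈ F[X]` be nonzero with `P ∈ F[X^s]`. Then both
`X^q div P` and `X^q mod P` lie in `F[X^s]`. -/
theorem div_and_mod_in_subfield_polynomial
    {F : Type*} [Field F] (p e h : ℕ) [CharP F p] (hp : 0 < p) (heh : e ≤ h)
    (P : Polynomial F) (hP : P ≠ 0) (hPs : inXpow (p ^ e) P) :
    inXpow (p ^ e) ((X : Polynomial F) ^ p ^ h / P) ∧
      inXpow (p ^ e) ((X : Polynomial F) ^ p ^ h % P) := by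
  have hs : 0 < p ^ e := pow_pos hp e
  have hX : (X : Polynomial F) ^ p ^ h = expand F (p ^ e) (X ^ p ^ (h - e)) := by
    rw [map_pow, expand_X, ← pow_mul, ← pow_add, Nat.add_sub_cancel' heh]
  have hE := exists_expand_of_inXpow _ hs P hPs
  have hB : contract (p ^ e) P ≠ 0 := by
    intro h0
    rw [h0, map_zero] at hE
    exact hP hE.symm
  obtain ⟨h1, h2⟩ := div_mod_expand _ hs (X ^ p ^ (h - e)) _ hB
  rw [hE, ← hX] at h1 h2
  rw [h1, h2]
  exact ⟨inXpow_expand_s18 _ hs _, inXpow_expand_s18 _ hs _⟩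
end
end
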